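/- The six functions c0, c1, c2, d0, d2, d3, regarded as elements of the ℂ-algebra of all functions {τ ∈ ℍ : E6(τ) ≠ 0} × ℂ⁴ → ℂ, are algebraically independent over ℂ. -/

import Mathlib

open MvPolynomial Complex

/-- `I2 = z1²+z2²+z3²+z4²` as a function on ℂ⁴ -/
noncomputable def fI2 (z : Fin 4 → ℂ) : ℂ := ∑ i, z i ^ 2

/-- `I4 = Σ_{i<j} zi²zj²` as a function on ℂ⁴ -/
noncomputable def fI4 (z : Fin 4 → ℂ) : ℂ :=
  ∑ p ∈ Finset.univ.filter (fun p : Fin 4 × Fin 4 => p.1 < p.2), z p.1 ^ 2 * z p.2 ^ 2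

/-- `I6 = Σ_{i<j<k} zi²zj²zk²` as a function on ℂ⁴ -/
noncomputable def fI6 (z : Fin 4 → ℂ) : ℂ :=
  ∑ p ∈ Finset.univ.filter (fun p : Fin 4 × Fin 4 × Fin 4 => p.1 < p.2.1 ∧ p.2.1 < p.2.2),
    z p.1 ^ 2 * z p.2.1 ^ 2 * z p.2.2 ^ 2

/-- `Ĩ4 = z1z2z3z4` as a function on ℂ⁴ -/
noncomputable def fI4t (z : Fin 4 → ℂ) : ℂ := ∏ i, z i

/-- `T1 = I4/6 − I2²/24` -/
noncomputable def fT1 (z : Fin 4 → ℂ) : ℂ := fI4 z / 6 - fI2 z ^ 2 / 24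

/-- `T2 = −I4/12 − Ĩ4/2 + I2²/48` -/
noncomputable def fT2 (z : Fin 4 → ℂ) : ℂ := -fI4 z / 12 - fI4t z / 2 + fI2 z ^ 2 / 48

/-- `T3 = −I4/12 + Ĩ4/2 + I2²/48` -/
noncomputable def fT3 (z : Fin 4 → ℂ) : ℂ := -fI4 z / 12 + fI4t z / 2 + fI2 z ^ 2 / 48

/-- `θ2(τ) = Σ_{n∈ℤ} q^{(n−1/2)²/2}`, `q = e^{2πiτ}` -/
noncomputable def theta2 (τ : ℂ) : ℂ :=
  ∑' n : ℤ, Complex.exp (Real.pi * Complex.I * τ * ((n : ℂ) - 1 / 2) ^ 2)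

/-- `θ3(τ) = Σ_{n∈ℤ} q^{n²/2}` -/
noncomputable def theta3 (τ : ℂ) : ℂ :=
  ∑' n : ℤ, Complex.exp (Real.pi * Complex.I * τ * (n : ℂ) ^ 2)

/-- `θ4(τ) = Σ_{n∈ℤ} (−1)ⁿ q^{n²/2}` -/
noncomputable def theta4 (τ : ℂ) : ℂ :=
  ∑' n : ℤ, (-1 : ℂ) ^ n * Complex.exp (Real.pi * Complex.I * τ * (n : ℂ) ^ 2)

/-- `e1 = (θ3⁴+θ4⁴)/12` -/
noncomputable def e1 (τ : ℂ) : ℂ := (theta3 τ ^ 4 + theta4 τ ^ 4) / 12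

/-- `e2 = (θ2⁴−θ4⁴)/12` -/
noncomputable def e2 (τ : ℂ) : ℂ := (theta2 τ ^ 4 - theta4 τ ^ 4) / 12

/-- `e3 = (−θ2⁴−θ3⁴)/12` -/
noncomputable def e3 (τ : ℂ) : ℂ := (-theta2 τ ^ 4 - theta3 τ ^ 4) / 12

/-- `K = I2` -/
noncomputable def Kf (_τ : ℂ) (z : Fin 4 → ℂ) : ℂ := fI2 z

/-- `L = e1·T1 + e2·T2 + e3·T3` -/
noncomputable def Lf (τ : ℂ) (z : Fin 4 → ℂ) : ℂ :=
  e1 τ * fT1 z + e2 τ * fT2 z + e3 τ * fT3 z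

/-- `M = 12(e1²·T1 + e2²·T2 + e3²·T3)` -/
noncomputable def Mf (τ : ℂ) (z : Fin 4 → ℂ) : ℂ :=
  12 * (e1 τ ^ 2 * fT1 z + e2 τ ^ 2 * fT2 z + e3 τ ^ 2 * fT3 z)

/-- `N = I6/4 − I2·I4/24 + I2³/96` -/
noncomputable def Nf (_τ : ℂ) (z : Fin 4 → ℂ) : ℂ :=
  fI6 z / 4 - fI2 z * fI4 z / 24 + fI2 z ^ 3 / 96

/-- `q = e^{2πiτ}` -/
noncomputable def qc (τ : ℂ) : ℂ := Complex.exp (2 * Real.pi * Complex.I * τ)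

/-- `E4(τ) = 1 + 240·Σ_{n≥1} n³qⁿ/(1−qⁿ)` -/
noncomputable def E4 (τ : ℂ) : ℂ :=
  1 + 240 * ∑' n : ℕ, ((n : ℂ) + 1) ^ 3 * qc τ ^ (n + 1) / (1 - qc τ ^ (n + 1))

/-- `E6(τ) = 1 − 504·Σ_{n≥1} n⁵qⁿ/(1−qⁿ)` -/
noncomputable def E6 (τ : ℂ) : ℂ :=
  1 - 504 * ∑' n : ℕ, ((n : ℂ) + 1) ^ 5 * qc τ ^ (n + 1) / (1 - qc τ ^ (n + 1))

/-- `Δ = (E4³ − E6²)/1728` -/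
noncomputable def Δf (τ : ℂ) : ℂ := (E4 τ ^ 3 - E6 τ ^ 2) / 1728

/-- `c0 = E4/12` -/
noncomputable def c0f (τ : ℂ) : ℂ := E4 τ / 12

/-- `c1 = −12·ΔK/E6` -/
noncomputable def c1f (τ : ℂ) (z : Fin 4 → ℂ) : ℂ := -12 * Δf τ * Kf τ z / E6 τ

/-- `c2 = E4²·ΔK²/(4E6²) − E6·L/24 + E4·M/24` -/
noncomputable def c2f (τ : ℂ) (z : Fin 4 → ℂ) : ℂ :=
  E4 τ ^ 2 * Δf τ * Kf τ z ^ 2 / (4 * E6 τ ^ 2) - E6 τ * Lf τ z / 24 + E4 τ * Mf τ z / 24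

/-- `d0 = E6/216` -/
noncomputable def d0f (τ : ℂ) : ℂ := E6 τ / 216

/-- `d2 = −E4·ΔK²/(24E6) − E4²·L/288 + E6·M/288` -/
noncomputable def d2f (τ : ℂ) (z : Fin 4 → ℂ) : ℂ :=
  -(E4 τ * Δf τ * Kf τ z ^ 2) / (24 * E6 τ) - E4 τ ^ 2 * Lf τ z / 288 + E6 τ * Mf τ z / 288

/-- `d3 = 2Δ²K³/E6² + E4·ΔK·L/(4E6) + Δ·N/4` -/
noncomputable def d3f (τ : ℂ) (z : Fin 4 → ℂ) : ℂ :=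
  2 * Δf τ ^ 2 * Kf τ z ^ 3 / E6 τ ^ 2 + E4 τ * Δf τ * Kf τ z * Lf τ z / (4 * E6 τ) +
    Δf τ * Nf τ z / 4

/-- The domain `{τ ∈ ℍ : E6(τ) ≠ 0} × ℂ⁴`. -/
def Dom6 : Type := {τ : ℂ // 0 < τ.im ∧ E6 τ ≠ 0} × (Fin 4 → ℂ)

open scoped MatrixGroups in
lemma ModularForm.levelOne_apply_smul {k : ℤ} (f : ModularForm 𝒮ℒ k) (γ : SL(2, ℤ))
    (z : UpperHalfPlane) : f (γ • z) = ((γ 1 0 : ℂ) * z + γ 1 1) ^ k * f z := by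
  have hγ : (γ : GL (Fin 2) ℝ) ∈ 𝒮ℒ := ⟨γ, rfl⟩
  simpa using! SlashInvariantForm.slash_action_eqn' f hγ z

lemma E4_eq_eisenstein (z : UpperHalfPlane) : E4 z = ModularForm.E₄ z := by
  have hq : ‖qc z‖ < 1 := UpperHalfPlane.norm_exp_two_pi_I_lt_one z
  have h := EisensteinSeries.q_expansion_bernoulli (k := 4) (by norm_num) ⟨2, rfl⟩ z
  rw [ModularForm.E₄, h, show bernoulli 4 = -1 / 30 by decide +kernel]
  have h2 := tsum_pow_div_one_sub_eq_tsum_sigma hq 3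
  rw [tsum_pnat_eq_tsum_succ (f := fun n : ℕ => (n : ℂ) ^ 3 * qc z ^ n / (1 - qc z ^ n))] at h2
  simp only [zpow_natCast]
  rw [show cexp (2 * Real.pi * I * z) = qc z from rfl, ← h2, E4]
  push_cast
  ring

lemma E6_eq_eisenstein (z : UpperHalfPlane) : E6 z = ModularForm.E₆ z := by
  have hq : ‖qc z‖ < 1 := UpperHalfPlane.norm_exp_two_pi_I_lt_one z
  have h := EisensteinSeries.q_expansion_bernoulli (k := 6) (by norm_num) ⟨3, rfl⟩ z
  rw [ModularForm.E₆, h, show bernoulli 6 = 1 / 42 by decide +kernel]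
  have h2 := tsum_pow_div_one_sub_eq_tsum_sigma hq 5
  rw [tsum_pnat_eq_tsum_succ (f := fun n : ℕ => (n : ℂ) ^ 5 * qc z ^ n / (1 - qc z ^ n))] at h2
  simp only [zpow_natCast]
  rw [show cexp (2 * Real.pi * I * z) = qc z from rfl, ← h2, E6]
  push_cast
  ring

lemma Δf_eq_discriminant (z : UpperHalfPlane) : Δf z = ModularForm.discriminant z := by
  rw [ModularForm.discriminant_eq_E₄_cube_sub_E₆_sq, Δf, E4_eq_eisenstein, E6_eq_eisenstein]

lemma Δf_ne_zero (z : UpperHalfPlane) : Δf z ≠ 0 := by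
  rw [Δf_eq_discriminant]
  exact ModularForm.discriminant_ne_zero z

open scoped Topology in
lemma tendsto_eisenstein_atImInfty {k : ℕ} (hk : 3 ≤ k) (hk2 : Even k) :
    Filter.Tendsto (ModularForm.E hk) UpperHalfPlane.atImInfty (𝓝 1) := by
  obtain ⟨c, hc, hO⟩ := ModularFormClass.exp_decay_sub_atImInfty' (ModularForm.E hk)
  have hv : UpperHalfPlane.valueAtInfty (ModularForm.E hk) = 1 := by
    rw [← EisensteinSeries.E_qExpansion_coeff_zero hk hk2]
    exact (UpperHalfPlane.qExpansion_coeff_zero one_pos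
      (ModularFormClass.analyticAt_cuspFunction_zero _ one_pos one_mem_strictPeriods_SL)
      (SlashInvariantFormClass.periodic_comp_ofComplex _ one_mem_strictPeriods_SL)).symm
  rw [hv] at hO
  have h0 : Filter.Tendsto (fun τ : UpperHalfPlane => Real.exp (-c * τ.im))
      UpperHalfPlane.atImInfty (𝓝 0) := by
    refine Real.tendsto_exp_atBot.comp ?_
    exact Filter.Tendsto.const_mul_atTop_of_neg (by linarith) Filter.tendsto_comap
  simpa using (hO.trans_tendsto h0).add_const 1

open scoped Topology in
/-- A polynomial relation between `E4` and `E6` on a vertical ray holds on the upper half-plane. -/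
lemma eval_eisenstein_eq_zero_of_ray (Q : MvPolynomial (Fin 2) ℂ) (T : ℝ)
    (h : ∀ t : ℝ, T < t → 0 < t → eval ![E4 (t * I), E6 (t * I)] Q = 0) (z : UpperHalfPlane) :
    eval ![ModularForm.E₄ z, ModularForm.E₆ z] Q = 0 := by
  set f : ℂ → Fin 2 → ℂ := fun w => ![(ModularForm.E₄ ∘ UpperHalfPlane.ofComplex) w,
    (ModularForm.E₆ ∘ UpperHalfPlane.ofComplex) w]
  have hf : ∀ i, AnalyticOnNhd ℂ (f · i) UpperHalfPlane.upperHalfPlaneSet := by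
    intro i
    fin_cases i
    · exact (UpperHalfPlane.mdifferentiable_iff.mp (ModularFormClass.holo
        ModularForm.E₄)).analyticOnNhd UpperHalfPlane.isOpen_upperHalfPlaneSet
    · exact (UpperHalfPlane.mdifferentiable_iff.mp (ModularFormClass.holo
        ModularForm.E₆)).analyticOnNhd UpperHalfPlane.isOpen_upperHalfPlaneSet
  have hQ := AnalyticOnNhd.aeval_mvPolynomial hf Q
  set t₀ : ℝ := |T| + 1
  have ht₀ : 0 < t₀ := by positivity
  have hTt : T < t₀ := (le_abs_self T).trans_lt (lt_add_one _)
  have hfreq : ∃ᶠ w in 𝓝[≠] ((t₀ : ℂ) * I), aeval (f w) Q = 0 := by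
    have hlim : Filter.Tendsto (fun t : ℝ => (t : ℂ) * I) (𝓝[>] t₀) (𝓝[≠] ((t₀ : ℂ) * I)) := by
      refine tendsto_nhdsWithin_iff.mpr ⟨?_, ?_⟩
      · exact (Continuous.tendsto (by fun_prop) t₀).mono_left nhdsWithin_le_nhds
      · filter_upwards [self_mem_nhdsWithin] with t ht heq
        have : (t : ℂ) = t₀ := mul_right_cancel₀ I_ne_zero heq
        exact (ne_of_gt ht) (by exact_mod_cast this)
    refine hlim.frequently (Filter.Eventually.frequently ?_)
    filter_upwards [self_mem_nhdsWithin] with t ht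
    have ht : t₀ < t := ht
    have him : 0 < ((t : ℂ) * I).im := by simpa using ht₀.trans ht
    have h1 := h t (hTt.trans ht) (ht₀.trans ht)
    have e4 := E4_eq_eisenstein ⟨_, him⟩
    have e6 := E6_eq_eisenstein ⟨_, him⟩
    simp only at e4 e6
    rw [e4, e6] at h1
    simp only [f, Function.comp_apply, UpperHalfPlane.ofComplex_apply_of_im_pos him]
    exact h1
  have := hQ.eqOn_zero_of_preconnected_of_frequently_eq_zero
    (convex_halfSpace_im_gt 0).isPreconnected (z₀ := (t₀ : ℂ) * I)
    (by simpa [UpperHalfPlane.upperHalfPlaneSet] using ht₀) hfreq z.im_pos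
  simpa [f] using! this

lemma polynomial_eval_aeval_pair {R : Type*} [CommSemiring R] (Q : MvPolynomial (Fin 2) R)
    (p q : Polynomial R) (y : R) :
    (aeval ![p, q] Q).eval y = eval ![p.eval y, q.eval y] Q := by
  induction Q using MvPolynomial.induction_on with
  | C a => simp
  | add f g hf hg => simp [hf, hg]
  | mul_X f i hf => fin_cases i <;> simp [hf]

open scoped MatrixGroups in
/-- A relation between `E₄` and `E₆` is isobaric for the weights `4` and `6`. -/
lemma eval_weighted_eisenstein_eq_zero (Q : MvPolynomial (Fin 2) ℂ)
    (h : ∀ z : UpperHalfPlane, eval ![ModularForm.E₄ z, ModularForm.E₆ z] Q = 0)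
    (z : UpperHalfPlane) (x : ℂ) :
    eval ![x ^ 4 * ModularForm.E₄ z, x ^ 6 * ModularForm.E₆ z] Q = 0 := by
  set p : Polynomial ℂ := aeval ![Polynomial.X ^ 4 * Polynomial.C (ModularForm.E₄ z),
    Polynomial.X ^ 6 * Polynomial.C (ModularForm.E₆ z)] Q
  have hp (y : ℂ) : p.eval y =
      eval ![y ^ 4 * ModularForm.E₄ z, y ^ 6 * ModularForm.E₆ z] Q := by
    simp [p, polynomial_eval_aeval_pair, mul_comm (y ^ 4), mul_comm (y ^ 6)]
  rw [← hp]
  suffices p = 0 by simp [this]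
  refine Polynomial.eq_zero_of_infinite_isRoot p
    (Set.infinite_of_injective_forall_mem (f := fun n : ℤ => (z : ℂ) + n) ?_ fun n => ?_)
  · intro m n hmn
    simpa using hmn
  · let γ : SL(2, ℤ) := ⟨!![0, -1; 1, n], by simp [Matrix.det_fin_two]⟩
    have h4 := ModularForm.levelOne_apply_smul ModularForm.E₄ γ z
    have h6 := ModularForm.levelOne_apply_smul ModularForm.E₆ γ z
    have hγ0 : γ 1 0 = 1 := rfl
    have hγ1 : γ 1 1 = n := rfl
    rw [hγ0, hγ1, Int.cast_one, one_mul] at h4 h6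
    have := h (γ • z)
    rw [h4, h6] at this
    change p.eval _ = 0
    rw [hp]
    exact_mod_cast this

/-- `E4` and `E6` satisfy no polynomial relation along a vertical ray. -/
lemma eq_zero_of_eisenstein_ray (Q : MvPolynomial (Fin 2) ℂ) (T : ℝ)
    (h : ∀ t : ℝ, T < t → 0 < t → eval ![E4 (t * I), E6 (t * I)] Q = 0) : Q = 0 := by
  have hQ := eval_weighted_eisenstein_eq_zero Q (eval_eisenstein_eq_zero_of_ray Q T h)
  set c : UpperHalfPlane → ℂ := fun z => ModularForm.E₄ z ^ 3 / ModularForm.E₆ z ^ 2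
  have h4 := tendsto_eisenstein_atImInfty (k := 4) (by norm_num) ⟨2, rfl⟩
  have h6 := tendsto_eisenstein_atImInfty (k := 6) (by norm_num) ⟨3, rfl⟩
  set U : Set UpperHalfPlane := {z | ModularForm.E₄ z ≠ 0 ∧ ModularForm.E₆ z ≠ 0}
  have hU : ∀ᶠ z in UpperHalfPlane.atImInfty, z ∈ U :=
    (h4.eventually_ne one_ne_zero).and (h6.eventually_ne one_ne_zero)
  have hc : Filter.Tendsto c UpperHalfPlane.atImInfty (nhds 1) := by
    have := (h4.pow 3).div (h6.pow 2) (by simp)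
    rwa [one_pow, one_pow, div_one] at this
  have hc1 : ∀ z ∈ U, c z ≠ 1 := by
    intro z hz h1
    refine ModularForm.discriminant_ne_zero z ?_
    rw [ModularForm.discriminant_eq_E₄_cube_sub_E₆_sq,
      (div_eq_one_iff_eq (pow_ne_zero 2 hz.2)).mp h1]
    simp
  have hinf : (c '' U).Infinite := by
    intro hfin
    have : ∀ᶠ z in UpperHalfPlane.atImInfty, c z ∈ (c '' U)ᶜ :=
      hc.eventually (hfin.isClosed.isOpen_compl.mem_nhds fun ⟨z, hz, hz1⟩ => hc1 z hz hz1)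
    obtain ⟨z, hz, hz'⟩ := (hU.and this).exists
    exact hz' ⟨z, hz, rfl⟩
  have hcurve (z : UpperHalfPlane) (hz : z ∈ U) (x y : ℂ) (hx : x ≠ 0) (hy : y ≠ 0)
      (hxy : x ^ 3 = c z * y ^ 2) : eval ![x, y] Q = 0 := by
    obtain ⟨hz4, hz6⟩ := hz
    obtain ⟨s, hs⟩ := IsAlgClosed.exists_pow_nat_eq
      (y * ModularForm.E₄ z / (x * ModularForm.E₆ z)) (n := 2) (by norm_num)
    have hxy' : x ^ 3 * ModularForm.E₆ z ^ 2 = ModularForm.E₄ z ^ 3 * y ^ 2 := by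
      simp only [c] at hxy
      field_simp at hxy
      linear_combination hxy
    have e4 : s ^ 4 * ModularForm.E₄ z = x := by
      rw [show s ^ 4 = (s ^ 2) ^ 2 by ring, hs]
      field_simp
      linear_combination -hxy'
    have e6 : s ^ 6 * ModularForm.E₆ z = y := by
      rw [show s ^ 6 = (s ^ 2) ^ 3 by ring, hs]
      field_simp
      linear_combination -hxy'
    simpa only [e4, e6] using hQ z s
  have hne (x y : ℂ) (hy : y ≠ 0) : eval ![x, y] Q = 0 := by
    suffices hp : aeval ![Polynomial.X, Polynomial.C y] Q = (0 : Polynomial ℂ) by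
      simpa [hp] using (polynomial_eval_aeval_pair Q Polynomial.X (Polynomial.C y) x).symm
    refine Polynomial.eq_zero_of_infinite_isRoot _ (Set.Infinite.of_image
      (fun x => x ^ 3 / y ^ 2) (hinf.mono ?_))
    rintro _ ⟨z, hz, rfl⟩
    obtain ⟨x, hx⟩ := IsAlgClosed.exists_pow_nat_eq (c z * y ^ 2) (n := 3) (by norm_num)
    have hx0 : x ≠ 0 := by
      rintro rfl
      have : c z * y ^ 2 ≠ 0 := mul_ne_zero
        (div_ne_zero (pow_ne_zero 3 hz.1) (pow_ne_zero 2 hz.2)) (pow_ne_zero 2 hy)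
      exact this (by simpa using hx.symm)
    refine ⟨x, ?_, ?_⟩
    · change Polynomial.eval _ _ = 0
      rw [polynomial_eval_aeval_pair]
      simpa using hcurve z hz x y hx0 hy hx
    · simp only [hx]
      field_simp
  refine MvPolynomial.funext fun v => ?_
  rw [map_zero, show v = ![v 0, v 1] by ext i; fin_cases i <;> rfl]
  suffices hp : aeval ![Polynomial.C (v 0), Polynomial.X] Q = (0 : Polynomial ℂ) by
    simpa [hp] using (polynomial_eval_aeval_pair Q (Polynomial.C (v 0)) Polynomial.X (v 1)).symm
  refine Polynomial.eq_zero_of_infinite_isRoot _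
    ((Set.finite_singleton (0 : ℂ)).infinite_compl.mono fun y hy => ?_)
  change Polynomial.eval _ _ = 0
  rw [polynomial_eval_aeval_pair]
  simpa using hne (v 0) y hy

lemma summable_exp_neg_mul_sq {t : ℝ} (ht : 0 < t) :
    Summable fun n : ℤ => Real.exp (-Real.pi * t * (n : ℝ) ^ 2) := by
  have h := ((summable_jacobiTheta₂_term_iff 0 (t * I)).mpr (by simpa using ht)).norm
  refine h.congr fun n => ?_
  rw [norm_jacobiTheta₂_term]
  simp
  ring_nf

lemma exp_half_shift_le {t : ℝ} (ht : 0 ≤ t) (n : ℤ) :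
    Real.exp (-Real.pi * t * ((n : ℝ) - 1 / 2) ^ 2) ≤
      Real.exp (-Real.pi * (t / 4) * (n : ℝ) ^ 2) := by
  rw [Real.exp_le_exp]
  have h : (n : ℝ) ^ 2 / 4 ≤ ((n : ℝ) - 1 / 2) ^ 2 := by
    have h0 : 0 ≤ (n - 1) * (3 * n - 1) := by
      rcases le_or_gt n 0 with hn | hn
      · nlinarith
      · exact mul_nonneg (by omega) (by omega)
    have h1 : (0 : ℝ) ≤ ((n : ℝ) - 1) * (3 * n - 1) := by exact_mod_cast h0
    nlinarith
  have := mul_le_mul_of_nonneg_left h (mul_nonneg Real.pi_pos.le ht)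
  linarith

lemma summable_exp_half_shift {t : ℝ} (ht : 0 < t) :
    Summable fun n : ℤ => Real.exp (-Real.pi * t * ((n : ℝ) - 1 / 2) ^ 2) :=
  (summable_exp_neg_mul_sq (t := t / 4) (by linarith)).of_nonneg_of_le
    (fun _ => (Real.exp_pos _).le) (exp_half_shift_le ht.le)

lemma theta2_imag (t : ℝ) : theta2 (t * I) =
    ((∑' n : ℤ, Real.exp (-Real.pi * t * ((n : ℝ) - 1 / 2) ^ 2) : ℝ) : ℂ) := by
  rw [theta2, ofReal_tsum]
  refine tsum_congr fun n => ?_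
  push_cast
  congr 1
  linear_combination (Real.pi * t * ((n : ℂ) - 1 / 2) ^ 2) * I_sq

lemma theta3_imag (t : ℝ) : theta3 (t * I) =
    ((∑' n : ℤ, Real.exp (-Real.pi * t * (n : ℝ) ^ 2) : ℝ) : ℂ) := by
  rw [theta3, ofReal_tsum]
  refine tsum_congr fun n => ?_
  push_cast
  congr 1
  linear_combination (Real.pi * t * (n : ℂ) ^ 2) * I_sq

lemma theta4_imag (t : ℝ) : theta4 (t * I) =
    ((∑' n : ℤ, (-1) ^ n * Real.exp (-Real.pi * t * (n : ℝ) ^ 2) : ℝ) : ℂ) := by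
  rw [theta4, ofReal_tsum]
  refine tsum_congr fun n => ?_
  push_cast
  congr 2
  linear_combination (Real.pi * t * (n : ℂ) ^ 2) * I_sq

lemma tendsto_tsum_exp_half_shift :
    Filter.Tendsto (fun t : ℝ => ∑' n : ℤ, Real.exp (-Real.pi * t * ((n : ℝ) - 1 / 2) ^ 2))
      Filter.atTop (nhds 0) := by
  rw [← tsum_zero (α := ℝ) (β := ℤ)]
  refine tendsto_tsum_of_dominated_convergence (summable_exp_half_shift one_pos) (fun n => ?_) ?_
  · refine Real.tendsto_exp_atBot.comp ?_
    have hn : (n : ℝ) - 1 / 2 ≠ 0 := by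
      intro h
      have h2 : (2 * n : ℝ) = 1 := by linarith
      have : 2 * n = 1 := by exact_mod_cast h2
      omega
    have h : -(Real.pi * ((n : ℝ) - 1 / 2) ^ 2) < 0 := by
      rw [neg_lt_zero]
      exact mul_pos Real.pi_pos (sq_pos_of_ne_zero hn)
    refine (Filter.tendsto_id.const_mul_atTop_of_neg h).congr fun t => ?_
    simp only [id_eq]
    ring
  · filter_upwards [Filter.eventually_ge_atTop 1] with t ht n
    rw [Real.norm_of_nonneg (Real.exp_pos _).le, Real.exp_le_exp]
    have := mul_le_mul_of_nonneg_right ht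
      (mul_nonneg Real.pi_pos.le (sq_nonneg ((n : ℝ) - 1 / 2)))
    linarith

lemma exists_ray_e_pairwise_ne : ∃ T : ℝ, ∀ t : ℝ, T < t → 0 < t →
    e1 (t * I) ≠ e2 (t * I) ∧ e1 (t * I) ≠ e3 (t * I) ∧ e2 (t * I) ≠ e3 (t * I) := by
  obtain ⟨T, hT⟩ := Filter.eventually_atTop.mp
    (tendsto_tsum_exp_half_shift.eventually_lt_const one_pos)
  refine ⟨T, fun t hTt ht => ?_⟩
  have hlt := hT t hTt.le
  have h2 := theta2_imag t
  have h3 := theta3_imag t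
  have h4 := theta4_imag t
  have hpos2 := (summable_exp_half_shift ht).tsum_pos (fun _ => (Real.exp_pos _).le) 0
    (Real.exp_pos _)
  have hone3 := (summable_exp_neg_mul_sq ht).le_tsum 0 fun _ _ => (Real.exp_pos _).le
  have habs : |∑' n : ℤ, (-1) ^ n * Real.exp (-Real.pi * t * (n : ℝ) ^ 2)| ≤
      ∑' n : ℤ, Real.exp (-Real.pi * t * (n : ℝ) ^ 2) := by
    rw [← Real.norm_eq_abs]
    refine tsum_of_norm_bounded (summable_exp_neg_mul_sq ht).hasSum fun n => ?_
    simp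
  set a := ∑' n : ℤ, Real.exp (-Real.pi * t * ((n : ℝ) - 1 / 2) ^ 2)
  set b := ∑' n : ℤ, Real.exp (-Real.pi * t * (n : ℝ) ^ 2)
  set c := ∑' n : ℤ, (-1) ^ n * Real.exp (-Real.pi * t * (n : ℝ) ^ 2)
  have ha0 : 0 < a ^ 4 := by positivity
  have ha1 : a ^ 4 < 1 := pow_lt_one₀ hpos2.le hlt (by norm_num)
  have hb : 1 ≤ b ^ 4 := one_le_pow₀ (by simpa using hone3)
  have hc0 : 0 ≤ c ^ 4 := by positivity
  have hcb : c ^ 4 ≤ b ^ 4 := by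
    have := pow_le_pow_left₀ (abs_nonneg c) habs 4
    rwa [Even.pow_abs ⟨2, rfl⟩] at this
  simp only [e1, e2, e3, h2, h3, h4]
  norm_cast
  refine ⟨?_, ?_, ?_⟩ <;> intro h <;> linarith

lemma fI2_eq (z : Fin 4 → ℂ) : fI2 z = z 0 ^ 2 + z 1 ^ 2 + z 2 ^ 2 + z 3 ^ 2 := by
  simp [fI2, Fin.sum_univ_four]

lemma fI4_eq (z : Fin 4 → ℂ) : fI4 z = z 0 ^ 2 * z 1 ^ 2 + z 0 ^ 2 * z 2 ^ 2 +
    z 0 ^ 2 * z 3 ^ 2 + z 1 ^ 2 * z 2 ^ 2 + z 1 ^ 2 * z 3 ^ 2 + z 2 ^ 2 * z 3 ^ 2 := by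
  rw [fI4, Finset.sum_filter, Fintype.sum_prod_type]
  simp [Fin.sum_univ_four]
  ring

lemma fI6_eq (z : Fin 4 → ℂ) : fI6 z = z 0 ^ 2 * z 1 ^ 2 * z 2 ^ 2 +
    z 0 ^ 2 * z 1 ^ 2 * z 3 ^ 2 + z 0 ^ 2 * z 2 ^ 2 * z 3 ^ 2 + z 1 ^ 2 * z 2 ^ 2 * z 3 ^ 2 := by
  rw [fI6, Finset.sum_filter, Fintype.sum_prod_type]
  simp [Fintype.sum_prod_type, Fin.sum_univ_four]

lemma fI4t_eq (z : Fin 4 → ℂ) : fI4t z = z 0 * z 1 * z 2 * z 3 := by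
  simp [fI4t, Fin.prod_univ_four]

/-- Four complex numbers with prescribed elementary symmetric functions. -/
lemma exists_esymm_four (a b c d : ℂ) : ∃ r s t u : ℂ, r + s + t + u = a ∧
    r * s + r * t + r * u + s * t + s * u + t * u = b ∧
    r * s * t + r * s * u + r * t * u + s * t * u = c ∧ r * s * t * u = d := by
  have h4 : ∃ r : ℂ, r ^ 4 - a * r ^ 3 + b * r ^ 2 - c * r + d = 0 := by
    have hdeg : (Polynomial.X ^ 4 - Polynomial.C a * Polynomial.X ^ 3 +
        Polynomial.C b * Polynomial.X ^ 2 - Polynomial.C c * Polynomial.X +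
        Polynomial.C d : Polynomial ℂ).degree = 4 := by compute_degree!
    obtain ⟨r, hr⟩ := IsAlgClosed.exists_root _ (hdeg.trans_ne (by norm_num))
    exact ⟨r, by simpa using hr⟩
  obtain ⟨r, hr⟩ := h4
  have h3 : ∃ s : ℂ, s ^ 3 - (a - r) * s ^ 2 + (b - r * (a - r)) * s -
      (c - r * (b - r * (a - r))) = 0 := by
    have hdeg : (Polynomial.X ^ 3 - Polynomial.C (a - r) * Polynomial.X ^ 2 +
        Polynomial.C (b - r * (a - r)) * Polynomial.X -
        Polynomial.C (c - r * (b - r * (a - r))) : Polynomial ℂ).degree = 3 := by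
      compute_degree!
    obtain ⟨s, hs⟩ := IsAlgClosed.exists_root _ (hdeg.trans_ne (by norm_num))
    exact ⟨s, by simpa using hs⟩
  obtain ⟨s, hs⟩ := h3
  obtain ⟨w, hw⟩ := IsAlgClosed.exists_pow_nat_eq
    ((a - r - s) ^ 2 - 4 * (b - r * (a - r) - s * (a - r - s))) (n := 2) (by norm_num)
  refine ⟨r, s, (a - r - s + w) / 2, (a - r - s - w) / 2, by ring, ?_, ?_, ?_⟩
  · linear_combination (-1 / 4) * hw
  · linear_combination (-1 / 4) * (r + s) * hw + hs
  · linear_combination (-1 / 4) * (r * s) * hw + r * hs - hr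

/-- The basic `D₄` Weyl invariants take arbitrary values simultaneously. -/
lemma exists_weyl_invariants_eq (a b c d : ℂ) :
    ∃ z : Fin 4 → ℂ, fI2 z = a ∧ fI4 z = b ∧ fI6 z = c ∧ fI4t z = d := by
  obtain ⟨r, s, t, u, h1, h2, h3, h4⟩ := exists_esymm_four a b c (d ^ 2)
  obtain ⟨x, rfl⟩ := IsAlgClosed.exists_pow_nat_eq r (n := 2) (by norm_num)
  obtain ⟨y, rfl⟩ := IsAlgClosed.exists_pow_nat_eq s (n := 2) (by norm_num)
  obtain ⟨v, rfl⟩ := IsAlgClosed.exists_pow_nat_eq t (n := 2) (by norm_num)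
  obtain ⟨w, rfl⟩ := IsAlgClosed.exists_pow_nat_eq u (n := 2) (by norm_num)
  have hd : (x * y * v * w) ^ 2 = d ^ 2 := by rw [← h4]; ring
  rcases sq_eq_sq_iff_eq_or_eq_neg.mp hd with hd | hd
  · refine ⟨![x, y, v, w], ?_, ?_, ?_, ?_⟩
    · rw [fI2_eq]; exact h1
    · rw [fI4_eq]; exact h2
    · rw [fI6_eq]; exact h3
    · rw [fI4t_eq]; exact hd
  · refine ⟨![x, y, v, -w], ?_, ?_, ?_, ?_⟩
    · simpa [fI2_eq] using h1
    · simpa [fI4_eq] using h2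
    · simpa [fI6_eq] using h3
    · simpa [fI4t_eq, neg_eq_iff_eq_neg] using hd

/-- Away from coincidences of `e1`, `e2`, `e3`, the functions `K, L, M, N` of `z` take arbitrary
values simultaneously. -/
lemma exists_KLMN_eq (τ : ℂ) (h12 : e1 τ ≠ e2 τ) (h13 : e1 τ ≠ e3 τ) (h23 : e2 τ ≠ e3 τ)
    (k l m n : ℂ) :
    ∃ z : Fin 4 → ℂ, Kf τ z = k ∧ Lf τ z = l ∧ Mf τ z = m ∧ Nf τ z = n := by
  have hsum : e1 τ + e2 τ + e3 τ = 0 := by simp only [e1, e2, e3]; ring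
  set a := e1 τ with ha
  set b := e2 τ with hb
  set c := e3 τ with hc
  have hab : b - a ≠ 0 := sub_ne_zero.mpr h12.symm
  have hac : c - a ≠ 0 := sub_ne_zero.mpr h13.symm
  have hbc : c - b ≠ 0 := sub_ne_zero.mpr h23.symm
  set t2 := ((c + a) * l - m / 12) / ((b - a) * (c - b)) with ht2
  set t3 := (m / 12 - (b + a) * l) / ((c - a) * (c - b)) with ht3
  have hl : a * (-t2 - t3) + b * t2 + c * t3 = l := by
    rw [ht2, ht3]; field_simp; ring
  have hm : 12 * (a ^ 2 * (-t2 - t3) + b ^ 2 * t2 + c ^ 2 * t3) = m := by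
    rw [ht2, ht3]; field_simp; ring
  obtain ⟨z, h1, h2, h3, h4⟩ := exists_weyl_invariants_eq k
    (6 * (-t2 - t3) + k ^ 2 / 4)
    (4 * (n + k * (6 * (-t2 - t3) + k ^ 2 / 4) / 24 - k ^ 3 / 96)) (t3 - t2)
  have hT1 : fT1 z = -t2 - t3 := by rw [fT1, h1, h2]; ring
  have hT2 : fT2 z = t2 := by rw [fT2, h1, h2, h4]; ring
  have hT3 : fT3 z = t3 := by rw [fT3, h1, h2, h4]; ring
  refine ⟨z, h1, ?_, ?_, ?_⟩
  · rw [Lf, hT1, hT2, hT3]; exact hl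
  · rw [Mf, hT1, hT2, hT3]; exact hm
  · rw [Nf, h1, h2, h3]; ring

/-- For fixed `τ`, the functions `c1, c2, d2, d3` of `z` take arbitrary values simultaneously. -/
lemma exists_coefficients_eq (τ : ℂ) (h12 : e1 τ ≠ e2 τ) (h13 : e1 τ ≠ e3 τ)
    (h23 : e2 τ ≠ e3 τ) (h6 : E6 τ ≠ 0) (hΔ : Δf τ ≠ 0) (x₁ x₂ y₂ y₃ : ℂ) :
    ∃ z : Fin 4 → ℂ, c1f τ z = x₁ ∧ c2f τ z = x₂ ∧ d2f τ z = y₂ ∧ d3f τ z = y₃ := by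
  have hΔ' : E4 τ ^ 3 - E6 τ ^ 2 = 1728 * Δf τ := by rw [Δf]; ring
  set p := E4 τ
  set q := E6 τ
  set δ := Δf τ
  set k := -(x₁ * q) / (12 * δ) with hk
  set u := 24 * (x₂ - p ^ 2 * δ * k ^ 2 / (4 * q ^ 2)) with hu
  set v := 288 * (y₂ + p * δ * k ^ 2 / (24 * q)) with hv
  set l := (q * u - p * v) / (1728 * δ) with hl
  set m := (p ^ 2 * u - q * v) / (1728 * δ) with hm
  have hlm1 : -q * l + p * m = u := by
    rw [hl, hm]; field_simp; linear_combination u * hΔ'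
  have hlm2 : -p ^ 2 * l + q * m = v := by
    rw [hl, hm]; field_simp; linear_combination v * hΔ'
  obtain ⟨z, hK, hL, hM, hN⟩ := exists_KLMN_eq τ h12 h13 h23 k l m
    (4 / δ * (y₃ - 2 * δ ^ 2 * k ^ 3 / q ^ 2 - p * δ * k * l / (4 * q)))
  refine ⟨z, ?_, ?_, ?_, ?_⟩
  · rw [c1f, hK, hk]
    change -12 * δ * (-(x₁ * q) / (12 * δ)) / q = x₁
    field_simp
  · rw [c2f, hK, hL, hM]; linear_combination hlm1 / 24 + hu / 24
  · rw [d2f, hK, hL, hM]; linear_combination hlm2 / 288 + hv / 288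
  · rw [d3f, hK, hL, hN]
    change 2 * δ ^ 2 * k ^ 3 / q ^ 2 + p * δ * k * l / (4 * q) +
      δ * (4 / δ * (y₃ - 2 * δ ^ 2 * k ^ 3 / q ^ 2 - p * δ * k * l / (4 * q))) / 4 = y₃
    rw [show ∀ w : ℂ, δ * (4 / δ * w) / 4 = w from fun w => by field_simp]
    ring

lemma exists_ray_E6_ne_zero : ∃ T : ℝ, ∀ t : ℝ, T < t → 0 < t → E6 (t * I) ≠ 0 := by
  have h := (tendsto_eisenstein_atImInfty (k := 6) (by norm_num) (by decide)).eventually_ne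
    one_ne_zero
  obtain ⟨A, hA⟩ := (UpperHalfPlane.atImInfty_mem _).mp h
  refine ⟨A, fun t ht ht0 => ?_⟩
  have him : 0 < ((t : ℂ) * I).im := by simpa using ht0
  have := hA ⟨t * I, him⟩ (by simpa [UpperHalfPlane.im] using ht.le)
  simpa [← E6_eq_eisenstein] using this

lemma aeval_coefficients_apply (P : MvPolynomial (Fin 6) ℂ) (p : Dom6) :
    aeval (![fun p : Dom6 => c0f p.1.1, fun p => c1f p.1.1 p.2, fun p => c2f p.1.1 p.2,
          fun p => d0f p.1.1, fun p => d2f p.1.1 p.2, fun p => d3f p.1.1 p.2] :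
        Fin 6 → (Dom6 → ℂ)) P p =
      eval ![c0f p.1.1, c1f p.1.1 p.2, c2f p.1.1 p.2, d0f p.1.1, d2f p.1.1 p.2, d3f p.1.1 p.2]
        P := by
  induction P using MvPolynomial.induction_on with
  | C a => simp
  | add P Q hP hQ => simp [hP, hQ]
  | mul_X P i hP =>
    simp only [map_mul, aeval_X, eval_X, Pi.mul_apply, hP]
    fin_cases i <;> rfl

/-- Substituting constants for all but two variables of a polynomial in six variables, and
rescaling the remaining two. -/
lemma eval_aeval_substitution (P : MvPolynomial (Fin 6) ℂ) (r s x₁ x₂ y₂ y₃ a b : ℂ) :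
    eval ![a, b] (aeval (![C r * X 0, C x₁, C x₂, C s * X 1, C y₂, C y₃] :
        Fin 6 → MvPolynomial (Fin 2) ℂ) P) =
      eval ![r * a, x₁, x₂, s * b, y₂, y₃] P := by
  induction P using MvPolynomial.induction_on with
  | C a => simp
  | add P Q hP hQ => simp only [map_add, hP, hQ]
  | mul_X P i hP =>
    simp only [map_mul, aeval_X, eval_X, hP]
    fin_cases i <;> simp

/-- The six functions `c0, c1, c2, d0, d2, d3`, as elements of the ℂ-algebra of functions
`{τ ∈ ℍ : E6(τ) ≠ 0} × ℂ⁴ → ℂ`, are algebraically independent over ℂ. -/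
theorem stmt_7 :
    AlgebraicIndependent ℂ
      (![fun p : Dom6 => c0f p.1.1, fun p => c1f p.1.1 p.2, fun p => c2f p.1.1 p.2,
          fun p => d0f p.1.1, fun p => d2f p.1.1 p.2, fun p => d3f p.1.1 p.2] :
        Fin 6 → (Dom6 → ℂ)) := by
  rw [algebraicIndependent_iff]
  intro P hP
  obtain ⟨T₁, hT₁⟩ := exists_ray_e_pairwise_ne
  obtain ⟨T₂, hT₂⟩ := exists_ray_E6_ne_zero
  refine MvPolynomial.funext fun v => ?_
  have hQ := eq_zero_of_eisenstein_ray
    (aeval ![C (1 / 12) * X 0, C (v 1), C (v 2), C (1 / 216) * X 1, C (v 4), C (v 5)] P)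
    (max T₁ T₂) fun t ht ht0 => by
      obtain ⟨h12, h13, h23⟩ := hT₁ t ((le_max_left _ _).trans_lt ht) ht0
      have h6 := hT₂ t ((le_max_right _ _).trans_lt ht) ht0
      have him : 0 < ((t : ℂ) * I).im := by simpa using ht0
      obtain ⟨z, h1, h2, h3, h4⟩ := exists_coefficients_eq (t * I) h12 h13 h23 h6
        (Δf_ne_zero ⟨t * I, him⟩) (v 1) (v 2) (v 4) (v 5)
      have h := aeval_coefficients_apply P (⟨t * I, him, h6⟩, z)
      rw [hP] at h
      change (0 : ℂ) = eval ![c0f (t * I), c1f (t * I) z, c2f (t * I) z, d0f (t * I),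
        d2f (t * I) z, d3f (t * I) z] P at h
      rw [eval_aeval_substitution]
      simpa [h1, h2, h3, h4, c0f, d0f, div_eq_inv_mul] using h.symm
  have h := eval_aeval_substitution P (1 / 12) (1 / 216) (v 1) (v 2) (v 4) (v 5)
    (12 * v 0) (216 * v 3)
  rw [hQ, map_zero] at h
  rw [map_zero, h]
  congr 2
  ext i
  fin_cases i <;> simp
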